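/- arXiv:2510.26246 — 5 statements merged into one kernel-verified Lean document; each statement's English description precedes it below -/
import Mathlib

section
/- For every n ≥ 1 and every perfect matching M₁ of the complete graph on 2n vertices, there exists a bipartite simple graph G on the same 2n vertices with exactly n(n+1)/2 edges such that M₁ is a perfect matching of G and M₁ is the unique perfect matching of G. -/
/-- `M` is a perfect matching of the simple graph `G`: every element of `M` is an
edge of `G`, and every vertex is incident to exactly one edge of `M`. -/
def IsPerfectMatchingOn {V : Type*} (G : SimpleGraph V) (M : Finset (Sym2 V)) : Prop :=
  (∀ e ∈ M, e ∈ G.edgeSet) ∧ ∀ v : V, ∃! e, e ∈ M ∧ v ∈ e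

theorem IsPerfectMatchingOn.eq_of_subset {V : Type*} {G H : SimpleGraph V} {M N : Finset (Sym2 V)}
    (hM : IsPerfectMatchingOn G M) (hN : IsPerfectMatchingOn H N) (hNM : N ⊆ M) : M = N := by
  refine Finset.Subset.antisymm (fun e he => ?_) hNM
  obtain ⟨v, hv⟩ : ∃ v, v ∈ e := ⟨_, e.out_fst_mem⟩
  obtain ⟨f, ⟨hf, hvf⟩, -⟩ := hN.2 v
  rwa [(hM.2 v).unique ⟨he, hv⟩ ⟨hNM hf, hvf⟩]

theorem IsPerfectMatchingOn.exists_involutive {V : Type*} {G : SimpleGraph V} {M : Finset (Sym2 V)}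
    (hM : IsPerfectMatchingOn G M) :
    ∃ p : V → V, p.Involutive ∧ (∀ v, p v ≠ v) ∧ ∀ e, e ∈ M ↔ ∃ v, e = s(v, p v) := by
  have hex : ∀ v, ∃ w, s(v, w) ∈ M := fun v => by
    obtain ⟨e, ⟨he, w, rfl⟩, -⟩ := hM.2 v
    exact ⟨w, he⟩
  choose p hp using hex
  refine ⟨p, fun v => ?_, fun v hv => ?_, fun e => ⟨fun he => ?_, ?_⟩⟩
  · have := (hM.2 (p v)).unique ⟨hp (p v), Sym2.mem_mk_left _ _⟩ ⟨hp v, Sym2.mem_mk_right _ _⟩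
    rw [Sym2.eq_swap] at this
    exact Sym2.congr_left.mp this
  · exact G.ne_of_adj (hM.1 _ (hp v)) hv.symm
  · exact ⟨_, (hM.2 _).unique ⟨he, e.out_fst_mem⟩ ⟨hp _, Sym2.mem_mk_left _ _⟩⟩
  · rintro ⟨v, rfl⟩
    exact hp v

/-- The half graph of an involution `p` of a linear order: `a` and `p b` are joined whenever
`a < p a`, `b < p b` and `a ≤ b`. -/
def involutionHalfGraph {V : Type*} [LinearOrder V] (p : V → V) : SimpleGraph V where
  Adj u v := (u < p u ∧ p v < v ∧ u ≤ p v) ∨ (v < p v ∧ p u < u ∧ v ≤ p u)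
  symm := ⟨fun _ _ h => h.symm⟩
  loopless := ⟨fun _ h => by rcases h with h | h <;> exact lt_asymm h.1 h.2.1⟩

section

variable {V : Type*} [LinearOrder V] {p : V → V}

theorem involutionHalfGraph_colorable : (involutionHalfGraph p).Colorable 2 := by
  refine (SimpleGraph.Coloring.mk (α := Bool) (fun v => decide (v < p v)) ?_).colorable
  rintro u v (⟨hu, hv, -⟩ | ⟨hv, hu, -⟩)
  · simp [hu, hv.le]
  · simp [hv, hu.le]

theorem involutionHalfGraph_adj_self_apply (hp : p.Involutive) (hne : ∀ v, p v ≠ v) (v : V) :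
    (involutionHalfGraph p).Adj v (p v) := by
  rcases (hne v).lt_or_gt with h | h
  · exact Or.inr ⟨by rwa [hp], h, le_rfl⟩
  · exact Or.inl ⟨h, by rwa [hp], (hp v).ge⟩

theorem two_mul_card_lt_involutive [Fintype V] (hp : p.Involutive) (hne : ∀ v, p v ≠ v) :
    2 * Fintype.card {v // v < p v} = Fintype.card V := by
  have e : {v // v < p v} ≃ {v // ¬ v < p v} :=
    hp.toPerm.subtypeEquiv fun v => by
      simp [hp v, le_iff_lt_or_eq, (hne v).symm]
  rw [← Fintype.card_congr (Equiv.sumCompl fun v => v < p v), Fintype.card_sum,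
    ← Fintype.card_congr e, two_mul]

theorem card_edgeSet_involutionHalfGraph [Fintype V] (hp : p.Involutive) :
    Nat.card (involutionHalfGraph p).edgeSet =
      (Fintype.card {v // v < p v} + 1).choose 2 := by
  let f : {q : {v // v < p v} × {v // v < p v} // q.1 ≤ q.2} → Sym2 V :=
    fun q => s(q.1.1, p q.1.2)
  have hf : f.Injective := by
    rintro ⟨⟨⟨a, ha⟩, ⟨b, hb⟩⟩, hab⟩ ⟨⟨⟨c, hc⟩, ⟨d, hd⟩⟩, hcd⟩ h
    rcases Sym2.eq_iff.mp h with ⟨h₁, h₂⟩ | ⟨h₁, h₂⟩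
    · obtain rfl : a = c := h₁
      obtain rfl : b = d := hp.injective h₂
      rfl
    · obtain rfl : a = p d := h₁
      rw [hp] at ha
      exact (lt_asymm ha hd).elim
  have hrange : (involutionHalfGraph p).edgeSet = Set.range f := by
    ext e
    induction e using Sym2.ind with
    | _ u v =>
      constructor
      · rintro (⟨hu, hv, huv⟩ | ⟨hv, hu, huv⟩)
        · exact ⟨⟨⟨⟨u, hu⟩, ⟨p v, by rwa [hp]⟩⟩, huv⟩, by simp [f, hp v]⟩
        · exact ⟨⟨⟨⟨v, hv⟩, ⟨p u, by rwa [hp]⟩⟩, huv⟩, by simp [f, hp u]⟩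
      · rintro ⟨⟨⟨⟨a, ha⟩, ⟨b, hb⟩⟩, hab⟩, h⟩
        rw [← h]
        exact Or.inl ⟨ha, by rwa [hp], by rw [hp]; exact hab⟩
  rw [hrange, Nat.card_range_of_injective hf, ← Nat.card_congr Sym2.sortEquiv,
    Nat.card_eq_fintype_card, Sym2.card]

theorem IsPerfectMatchingOn.mem_of_involutionHalfGraph [WellFoundedGT V] (hp : p.Involutive)
    (hne : ∀ v, p v ≠ v) {M : Finset (Sym2 V)}
    (hM : IsPerfectMatchingOn (involutionHalfGraph p) M) (v : V) : s(v, p v) ∈ M := by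
  have hlt : ∀ a, a < p a → s(a, p a) ∈ M := by
    intro a
    induction a using WellFoundedGT.induction with
    | _ a ih =>
      intro ha
      obtain ⟨e, ⟨he, w, rfl⟩, -⟩ := hM.2 a
      rcases hM.1 _ he with ⟨-, hw, haw⟩ | ⟨-, ha', -⟩
      · rcases haw.lt_or_eq with h | h
        · have hmem := ih (p w) h (by rwa [hp])
          rw [hp] at hmem
          have := (hM.2 w).unique ⟨he, Sym2.mem_mk_right _ _⟩ ⟨hmem, Sym2.mem_mk_right _ _⟩
          exact absurd (Sym2.congr_left.mp this) h.ne
        · rwa [show p a = w from (congrArg p h).trans (hp w)]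
      · exact (lt_asymm ha ha').elim
  rcases (hne v).lt_or_gt with h | h
  · have := hlt (p v) (by rwa [hp])
    rwa [hp, Sym2.eq_swap] at this
  · exact hlt v h

end

/-- For every `n ≥ 1` and every perfect matching `M₁` of the complete graph on `2n`
vertices, there exists a bipartite simple graph `G` on the same vertices with exactly
`n(n+1)/2` edges such that `M₁` is the unique perfect matching of `G`. -/
theorem exists_bipartite_with_unique_perfect_matching (n : ℕ) (hn : 1 ≤ n)
    (M₁ : Finset (Sym2 (Fin (2 * n))))
    (hM₁ : IsPerfectMatchingOn (⊤ : SimpleGraph (Fin (2 * n))) M₁) :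
    ∃ G : SimpleGraph (Fin (2 * n)),
      G.Colorable 2 ∧
      Nat.card G.edgeSet = n * (n + 1) / 2 ∧
      IsPerfectMatchingOn G M₁ ∧
      ∀ M : Finset (Sym2 (Fin (2 * n))), IsPerfectMatchingOn G M → M = M₁ := by
  obtain ⟨p, hp, hne, hmem⟩ := hM₁.exists_involutive
  have hM : IsPerfectMatchingOn (involutionHalfGraph p) M₁ := by
    refine ⟨fun e he => ?_, hM₁.2⟩
    obtain ⟨v, rfl⟩ := (hmem e).mp he
    exact involutionHalfGraph_adj_self_apply hp hne v
  refine ⟨involutionHalfGraph p, involutionHalfGraph_colorable, ?_, hM, fun M hM' => ?_⟩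
  · have hcard := two_mul_card_lt_involutive hp hne
    rw [Fintype.card_fin] at hcard
    rw [card_edgeSet_involutionHalfGraph hp, Nat.mul_left_cancel two_pos hcard,
      Nat.choose_two_right, Nat.add_sub_cancel, mul_comm]
  · refine hM'.eq_of_subset hM fun e he => ?_
    obtain ⟨v, rfl⟩ := (hmem e).mp he
    exact hM'.mem_of_involutionHalfGraph hp hne v
end

section
/- Let f : ℕ → ℝ satisfy f(i) ≥ 0 for all i, Σ_{i=0}^∞ f(i) = 1, and f(i) ≤ p for all i, where 0 < p ≤ 1. Then the expectation Σ_{i=0}^∞ i · f(i) is at least (⌊1/p⌋ − 1)/2. -/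
open scoped ENNReal

theorem sum_range_tsub_mul_two (M : ℕ) :
    (∑ i ∈ Finset.range (M + 1), (M - i)) * 2 = (M + 1) * M := by
  have h := Finset.sum_range_reflect (fun i => i) (M + 1)
  simp only [Nat.add_sub_cancel] at h
  rw [h, Finset.sum_range_id_mul_two, Nat.add_sub_cancel]

theorem tsum_tsub_mul_le {p : ℝ} {M : ℕ} (hM : ((M : ℝ) + 1) * p ≤ 1) :
    ∑' i : ℕ, ((M - i : ℕ) : ℝ≥0∞) * ENNReal.ofReal p ≤ ENNReal.ofReal ((M : ℝ) / 2) := by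
  rw [tsum_eq_sum (s := Finset.range (M + 1)), ← Finset.sum_mul, ← Nat.cast_sum,
    ← ENNReal.ofReal_natCast, ← ENNReal.ofReal_mul (Nat.cast_nonneg _)]
  · apply ENNReal.ofReal_le_ofReal
    have h : ((∑ i ∈ Finset.range (M + 1), (M - i) : ℕ) : ℝ) * 2 = (M + 1) * M := by
      exact_mod_cast sum_range_tsub_mul_two M
    nlinarith [mul_le_mul_of_nonneg_left hM (Nat.cast_nonneg (α := ℝ) M)]
  · intro i hi
    have : M - i = 0 := by
      rw [Finset.mem_range] at hi
      omega
    simp [this]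

/-- If `f` is a probability mass function on `ℕ` with `f i ≤ p` for every `i`
(`0 < p ≤ 1`), then the expectation `Σ i·f(i)` (in `[0,∞]`) is at least
`(⌊1/p⌋ - 1) / 2`. -/
theorem expectation_ge_of_pmf_le (p : ℝ) (hp : 0 < p) (hp1 : p ≤ 1)
    (f : ℕ → ℝ) (hnn : ∀ i, 0 ≤ f i) (hsum : ∑' i, f i = 1)
    (hle : ∀ i, f i ≤ p) :
    ENNReal.ofReal (((⌊1 / p⌋₊ : ℝ) - 1) / 2)
      ≤ ∑' i : ℕ, (i : ℝ≥0∞) * ENNReal.ofReal (f i) := by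
  obtain ⟨M, hM⟩ : ∃ M, ⌊1 / p⌋₊ = M + 1 :=
    Nat.exists_eq_succ_of_ne_zero (Nat.floor_pos.2 ((one_le_div hp).2 hp1)).ne'
  have hMp : ((M : ℝ) + 1) * p ≤ 1 := by
    have h := Nat.floor_le (one_div_nonneg.2 hp.le)
    rw [hM, le_div_iff₀ hp] at h
    exact_mod_cast h
  have hf : Summable f := by
    by_contra h
    simp [tsum_eq_zero_of_not_summable h] at hsum
  have hmass : ∑' i, ENNReal.ofReal (f i) = 1 := by
    rw [← ENNReal.ofReal_tsum_of_nonneg hnn hf, hsum, ENNReal.ofReal_one]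
  have key : (M : ℝ≥0∞) ≤ (∑' i : ℕ, (i : ℝ≥0∞) * ENNReal.ofReal (f i))
      + ENNReal.ofReal ((M : ℝ) / 2) := calc
    (M : ℝ≥0∞) = ∑' i, (M : ℝ≥0∞) * ENNReal.ofReal (f i) := by
      rw [ENNReal.tsum_mul_left, hmass, mul_one]
    _ ≤ ∑' i : ℕ, ((i : ℝ≥0∞) * ENNReal.ofReal (f i)
          + ((M - i : ℕ) : ℝ≥0∞) * ENNReal.ofReal p) := by
      refine ENNReal.tsum_le_tsum fun i => ?_
      calc (M : ℝ≥0∞) * ENNReal.ofReal (f i)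
          ≤ ((i : ℝ≥0∞) + ((M - i : ℕ) : ℝ≥0∞)) * ENNReal.ofReal (f i) := by
            gcongr
            exact_mod_cast (by omega : M ≤ i + (M - i))
        _ ≤ _ := by
            rw [add_mul]
            gcongr
            exact hle i
    _ ≤ _ := by
      rw [ENNReal.tsum_add]
      gcongr
      exact tsum_tsub_mul_le hMp
  have hhalf : (M : ℝ≥0∞) = ENNReal.ofReal ((M : ℝ) / 2) + ENNReal.ofReal ((M : ℝ) / 2) := by
    rw [← ENNReal.ofReal_add (by positivity) (by positivity), add_halves, ENNReal.ofReal_natCast]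
  rw [hM, Nat.cast_add, Nat.cast_one, add_sub_cancel_right]
  rw [hhalf] at key
  exact (ENNReal.add_le_add_iff_right ENNReal.ofReal_ne_top).1 key
end

section
/- Let X be a nonempty finite set, P : X × X → ℝ a row-stochastic matrix, π a stationary probability distribution for P, and Y ⊆ X a subset with π(Y) := Σ_{x∈Y} π_x > 0. Let f : ℕ → ℝ be the first-hitting distribution of Y started from π, and define the expected hitting time τ = Σ_{j=1}^∞ (1 − Σ_{i=0}^{j−1} f(i)), a value in [0, ∞]. Then τ ≥ (⌊π(Y)^{−1}⌋ − 1)/2. -/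
open scoped ENNReal

/-- The first-hitting distribution of a set `Y ⊆ X`, for a Markov chain with
transition matrix `P` started from the initial distribution `π`:
`f 0 = Σ_{x ∈ Y} π x`, and for `i ≥ 1`, `f i` is the sum, over all sequences
`x_0, x_1, …, x_i` of elements of `X` with `x_0, …, x_{i-1} ∉ Y` and `x_i ∈ Y`,
of `π x_0 · ∏_{j=0}^{i-1} P (x_j) (x_{j+1})`. -/
noncomputable def hitDist {X : Type*} [Fintype X] [DecidableEq X]
    (P : X → X → ℝ) (π : X → ℝ) (Y : Finset X) : ℕ → ℝ
  | 0 => ∑ x ∈ Y, π x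
  | (i + 1) =>
      ∑ x ∈ Finset.univ.filter
          (fun x : Fin (i + 2) → X =>
            (∀ j : Fin (i + 1), x j.castSucc ∉ Y) ∧ x (Fin.last (i + 1)) ∈ Y),
        π (x 0) * ∏ j : Fin (i + 1), P (x j.castSucc) (x j.succ)

/-- The expected hitting time `τ = Σ_{j=1}^∞ (1 - Σ_{i=0}^{j-1} f(i))`, a value in
`[0, ∞]`, of `Y` for the chain `P` started from `π`. -/
noncomputable def expHitTime {X : Type*} [Fintype X] [DecidableEq X]
    (P : X → X → ℝ) (π : X → ℝ) (Y : Finset X) : ℝ≥0∞ :=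
  ∑' j : ℕ, ENNReal.ofReal (1 - ∑ i ∈ Finset.range (j + 1), hitDist P π Y i)

/-- A stationary distribution is invariant under any number of steps of the chain, expressed
as a sum over trajectories weighted by a function of the endpoint. -/
theorem sum_trajectories_of_stationary {X : Type*} [Fintype X]
    (P : X → X → ℝ) (π : X → ℝ) (hstat : ∀ b, ∑ a, π a * P a b = π b) (g : X → ℝ) (n : ℕ) :
    ∑ x : Fin (n + 1) → X,
      π (x 0) * (∏ j : Fin n, P (x j.castSucc) (x j.succ)) * g (x (Fin.last n)) =
      ∑ y, π y * g y := by
  induction n with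
  | zero =>
    exact Fintype.sum_equiv (Equiv.funUnique (Fin 1) X) _ _ fun x => by simp
  | succ n ih =>
    rw [← ih, ← (Fin.consEquiv fun _ : Fin (n + 2) => X).sum_comp, Fintype.sum_prod_type,
      Finset.sum_comm]
    refine Finset.sum_congr rfl fun x _ => ?_
    rw [← hstat (x 0), Finset.sum_mul, Finset.sum_mul]
    refine Finset.sum_congr rfl fun a _ => ?_
    rw [Fin.prod_univ_succ]
    simp only [Fin.consEquiv_apply, Fin.cons_zero, Fin.castSucc_zero, Fin.cons_succ,
      ← Fin.succ_castSucc, ← Fin.succ_last]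
    ring

theorem hitDist_le {X : Type*} [Fintype X] [DecidableEq X]
    (P : X → X → ℝ) (hPnn : ∀ a b, 0 ≤ P a b) (π : X → ℝ) (hπnn : ∀ x, 0 ≤ π x)
    (hstat : ∀ b, ∑ a, π a * P a b = π b) (Y : Finset X) (i : ℕ) :
    hitDist P π Y i ≤ ∑ x ∈ Y, π x := by
  cases i with
  | zero => exact le_rfl
  | succ i =>
    have h := sum_trajectories_of_stationary P π hstat (fun y => if y ∈ Y then 1 else 0) (i + 1)
    simp only [mul_ite, mul_one, mul_zero, Finset.sum_ite_mem, Finset.univ_inter] at h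
    rw [← h, ← Finset.sum_filter]
    refine Finset.sum_le_sum_of_subset_of_nonneg ?_ fun x _ _ =>
      mul_nonneg (hπnn _) (Finset.prod_nonneg fun _ _ => hPnn _ _)
    intro x hx
    simp only [Finset.mem_filter, Finset.mem_univ, true_and] at hx ⊢
    exact hx.2

/-- If `P` is row-stochastic, `π` is a stationary probability distribution for `P`,
and `Y ⊆ X` has `π(Y) > 0`, then the expected hitting time `τ` of `Y` started from
`π` satisfies `τ ≥ (⌊π(Y)⁻¹⌋ - 1) / 2`. -/
theorem expHitTime_ge {X : Type*} [Fintype X] [DecidableEq X] [Nonempty X]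
    (P : X → X → ℝ) (hPnn : ∀ a b, 0 ≤ P a b) (hProw : ∀ a, ∑ b, P a b = 1)
    (π : X → ℝ) (hπnn : ∀ x, 0 ≤ π x) (hπsum : ∑ x, π x = 1)
    (hstat : ∀ b, ∑ a, π a * P a b = π b)
    (Y : Finset X) (hY : 0 < ∑ x ∈ Y, π x) :
    ENNReal.ofReal (((⌊(∑ x ∈ Y, π x)⁻¹⌋₊ : ℝ) - 1) / 2) ≤ expHitTime P π Y := by
  set p := ∑ x ∈ Y, π x
  set n := ⌊p⁻¹⌋₊
  have hnp : (n : ℝ) * p ≤ 1 := by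
    have h := Nat.floor_le (inv_nonneg.mpr hY.le)
    calc (n : ℝ) * p ≤ p⁻¹ * p := by gcongr
      _ = 1 := inv_mul_cancel₀ hY.ne'
  have partial_sum (m : ℕ) :
      ∑ j ∈ Finset.range m, (1 - ((j : ℝ) + 1) * p) = m - m * (m + 1) / 2 * p := by
    induction m with
    | zero => simp
    | succ m ih => rw [Finset.sum_range_succ, ih]; push_cast; ring
  calc ENNReal.ofReal (((n : ℝ) - 1) / 2)
      ≤ ENNReal.ofReal (∑ j ∈ Finset.range n, (1 - ((j : ℝ) + 1) * p)) := by
        refine ENNReal.ofReal_le_ofReal ?_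
        rw [partial_sum]
        nlinarith [mul_le_mul_of_nonneg_left hnp (by positivity : (0 : ℝ) ≤ n + 1)]
    _ = ∑ j ∈ Finset.range n, ENNReal.ofReal (1 - ((j : ℝ) + 1) * p) := by
        refine ENNReal.ofReal_sum_of_nonneg fun j hj => ?_
        have hj' : (j : ℝ) + 1 ≤ n := by exact_mod_cast Finset.mem_range.mp hj
        nlinarith
    _ ≤ ∑ j ∈ Finset.range n,
          ENNReal.ofReal (1 - ∑ i ∈ Finset.range (j + 1), hitDist P π Y i) := by
        refine Finset.sum_le_sum fun j _ => ENNReal.ofReal_le_ofReal ?_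
        have h := Finset.sum_le_card_nsmul (Finset.range (j + 1)) (hitDist P π Y) p
          fun i _ => hitDist_le P hPnn π hπnn hstat Y i
        simp only [Finset.card_range, nsmul_eq_mul] at h
        push_cast at h
        linarith
    _ ≤ expHitTime P π Y := ENNReal.sum_le_tsum _
end

section
/- Let n ≥ 1 and let m be a natural number with m ≥ n. Let X be a nonempty finite set, let π be a probability distribution on X, and let ξ : X → (finite sets of edges of the complete graph K on 2n vertices) satisfy |ξ(x)| ≤ m for all x ∈ X. Then there exists a perfect matching M of K such that π({x ∈ X : M ⊆ ξ(x)}) ≤ 2^n · m^n / (2n)!. -/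
/-- The perfect matching of `V` obtained by pairing `σ (0, i)` with `σ (1, i)`. -/
def pairing {ι V : Type*} [Fintype ι] [DecidableEq V] (σ : Fin 2 × ι ≃ V) : Finset (Sym2 V) :=
  Finset.univ.image fun i => s(σ (0, i), σ (1, i))

theorem pairing_isPerfectMatchingOn {ι V : Type*} [Fintype ι] [DecidableEq V]
    (σ : Fin 2 × ι ≃ V) : IsPerfectMatchingOn (⊤ : SimpleGraph V) (pairing σ) := by
  refine ⟨?_, fun v => ?_⟩
  · intro e he
    obtain ⟨i, -, rfl⟩ := Finset.mem_image.1 he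
    simp
  · obtain ⟨⟨a, i⟩, rfl⟩ := σ.surjective v
    refine ⟨s(σ (0, i), σ (1, i)),
      ⟨Finset.mem_image_of_mem _ (Finset.mem_univ i), ?_⟩, ?_⟩
    · fin_cases a <;> simp
    · rintro e ⟨he, hv⟩
      obtain ⟨j, -, rfl⟩ := Finset.mem_image.1 he
      have hij : i = j := by
        rcases Sym2.mem_iff.1 hv with h | h
        · exact congrArg Prod.snd (σ.injective h)
        · exact congrArg Prod.snd (σ.injective h)
      rw [hij]

theorem card_orderedPairs_le {V : Type*} [Fintype V] [DecidableEq V] (E : Finset (Sym2 V)) :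
    (Finset.univ.filter fun p : V × V => s(p.1, p.2) ∈ E).card ≤ 2 * E.card := by
  refine Finset.card_le_mul_card_image_of_maps_to (f := fun p : V × V => s(p.1, p.2))
    (fun p hp => (Finset.mem_filter.1 hp).2) 2 fun e _ => ?_
  induction e with | _ a b
  refine (Finset.card_le_card (t := {(a, b), (b, a)}) ?_).trans Finset.card_le_two
  rintro ⟨c, d⟩ hp
  simpa using (Finset.mem_filter.1 hp).2

theorem card_pairing_subset_le {ι V : Type*} [Fintype ι] [DecidableEq ι] [Fintype V]
    [DecidableEq V] (E : Finset (Sym2 V)) :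
    (Finset.univ.filter fun σ : Fin 2 × ι ≃ V => pairing σ ⊆ E).card
      ≤ (2 * E.card) ^ Fintype.card ι := by
  set D := Finset.univ.filter fun p : V × V => s(p.1, p.2) ∈ E
  calc
    _ ≤ (Fintype.piFinset fun _ : ι => D).card := by
      refine Finset.card_le_card_of_injOn (fun σ i => (σ (0, i), σ (1, i))) ?_ ?_
      · intro σ hσ
        have hσ' := (Finset.mem_filter.1 hσ).2
        refine Finset.mem_coe.2 (Fintype.mem_piFinset.2 fun i => ?_)
        exact Finset.mem_filter.2 ⟨Finset.mem_univ _,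
          hσ' (Finset.mem_image_of_mem _ (Finset.mem_univ i))⟩
      · intro σ _ τ _ h
        ext ⟨a, i⟩
        have hi := Prod.ext_iff.1 (congrFun h i)
        fin_cases a
        · exact hi.1
        · exact hi.2
    _ = D.card ^ Fintype.card ι := by simp
    _ ≤ _ := Nat.pow_le_pow_left (card_orderedPairs_le E) _

/-- Let `n ≥ 1`, `m ≥ n`, let `π` be a probability distribution on a nonempty finite
set `X`, and let `ξ` assign to each `x ∈ X` a set of at most `m` edges of the complete
graph `K` on `2n` vertices. Then there is a perfect matching `M` of `K` with
`π({x : M ⊆ ξ x}) ≤ 2^n · m^n / (2n)!`. -/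
theorem exists_matching_small_prob (n m : ℕ) (hn : 1 ≤ n) (hm : n ≤ m)
    {X : Type*} [Fintype X] [Nonempty X]
    (π : X → ℝ) (hπnn : ∀ x, 0 ≤ π x) (hπsum : ∑ x, π x = 1)
    (ξ : X → Finset (Sym2 (Fin (2 * n))))
    (hξedge : ∀ x, ∀ e ∈ ξ x, e ∈ (⊤ : SimpleGraph (Fin (2 * n))).edgeSet)
    (hξcard : ∀ x, (ξ x).card ≤ m) :
    ∃ M : Finset (Sym2 (Fin (2 * n))),
      IsPerfectMatchingOn (⊤ : SimpleGraph (Fin (2 * n))) M ∧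
      ∑ x ∈ Finset.univ.filter (fun x => M ⊆ ξ x), π x
        ≤ 2 ^ n * (m : ℝ) ^ n / ((2 * n).factorial : ℝ) := by
  have hcard : Fintype.card (Fin 2 × Fin n ≃ Fin (2 * n)) = (2 * n).factorial := by
    rw [Fintype.card_equiv finProdFinEquiv]
    simp
  have hbound : ∑ σ : Fin 2 × Fin n ≃ Fin (2 * n),
      ∑ x ∈ Finset.univ.filter (fun x => pairing σ ⊆ ξ x), π x ≤ 2 ^ n * (m : ℝ) ^ n := by
    calc
      _ = ∑ x, ((Finset.univ.filter fun σ : Fin 2 × Fin n ≃ Fin (2 * n) =>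
          pairing σ ⊆ ξ x).card : ℝ) * π x := by
        simp_rw [Finset.sum_filter]
        rw [Finset.sum_comm]
        simp_rw [← Finset.sum_filter, Finset.sum_const, nsmul_eq_mul]
      _ ≤ ∑ x, (2 ^ n * (m : ℝ) ^ n) * π x := by
        refine Finset.sum_le_sum fun x _ => mul_le_mul_of_nonneg_right ?_ (hπnn x)
        have h := (card_pairing_subset_le (ι := Fin n) (ξ x)).trans
          (Nat.pow_le_pow_left (Nat.mul_le_mul_left 2 (hξcard x)) _)
        rw [Fintype.card_fin, mul_pow] at h
        exact_mod_cast h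
      _ = _ := by rw [← Finset.mul_sum, hπsum, mul_one]
  obtain ⟨σ, -, hσ⟩ := Finset.exists_le_of_sum_le
    (s := (Finset.univ : Finset (Fin 2 × Fin n ≃ Fin (2 * n))))
    (f := fun σ => ∑ x ∈ Finset.univ.filter (fun x => pairing σ ⊆ ξ x), π x)
    (g := fun _ => 2 ^ n * (m : ℝ) ^ n / ((2 * n).factorial : ℝ))
    ⟨finProdFinEquiv, Finset.mem_univ _⟩ (by
      rw [Finset.sum_const, Finset.card_univ, hcard, nsmul_eq_mul,
        mul_div_cancel₀ _ (by positivity)]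
      exact hbound)
  exact ⟨pairing σ, pairing_isPerfectMatchingOn σ, hσ⟩
end

section
/- Let n ≥ 1 and let m be a natural number with m ≥ n. Let X be a nonempty finite set, P : X × X → ℝ a row-stochastic matrix, π a stationary probability distribution for P, and ξ : X → (finite sets of edges of the complete graph K on 2n vertices) a function with |ξ(x)| ≤ m for all x ∈ X. Then there exists a perfect matching M of K such that, setting Y = {x ∈ X : M ⊆ ξ(x)} and letting τ = Σ_{j=1}^∞ (1 − Σ_{i=0}^{j−1} f(i)) be the expected hitting time of Y started from π (a value in [0,∞]), one has τ ≥ (⌊(2n)!/(2^n · m^n)⌋ − 1)/2. -/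
open scoped ENNReal

/-- A path of a stationary chain is distributed according to `π` at its last step. -/
lemma sum_path_eq_of_stationary {X : Type*} [Fintype X]
    {P : X → X → ℝ} {π : X → ℝ} (hstat : ∀ b, ∑ a, π a * P a b = π b) (h : X → ℝ) (i : ℕ) :
    ∑ x : Fin (i + 1) → X,
      π (x 0) * (∏ j : Fin i, P (x j.castSucc) (x j.succ)) * h (x (Fin.last i)) =
      ∑ x, π x * h x := by
  induction i with
  | zero =>
    rw [← (Equiv.funUnique (Fin 1) X).symm.sum_comp]
    simp
  | succ i ih =>
    rw [← ih, ← (Fin.consEquiv fun _ : Fin (i + 2) => X).sum_comp, Fintype.sum_prod_type_right]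
    refine Finset.sum_congr rfl fun y _ => ?_
    rw [← hstat (y 0), Finset.sum_mul, Finset.sum_mul]
    refine Finset.sum_congr rfl fun a _ => ?_
    rw [Fin.prod_univ_succ]
    simp only [Fin.consEquiv_apply, Fin.cons_zero, Fin.castSucc_zero, Fin.cons_succ,
      ← Fin.succ_castSucc, ← Fin.succ_last]
    ring

/-- For a stationary chain, the probability of first hitting `Y` at time `i` is at most the
stationary mass of `Y`. -/
lemma hitDist_le_sum_of_stationary {X : Type*} [Fintype X] [DecidableEq X]
    {P : X → X → ℝ} (hPnn : ∀ a b, 0 ≤ P a b) {π : X → ℝ} (hπnn : ∀ x, 0 ≤ π x)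
    (hstat : ∀ b, ∑ a, π a * P a b = π b) (Y : Finset X) (i : ℕ) :
    hitDist P π Y i ≤ ∑ x ∈ Y, π x := by
  cases i with
  | zero => exact le_rfl
  | succ i =>
    have hY : ∑ x ∈ Y, π x = ∑ x, π x * (if x ∈ Y then 1 else 0) := by simp
    rw [hY, ← sum_path_eq_of_stationary hstat _ (i + 1), hitDist, Finset.sum_filter]
    refine Finset.sum_le_sum fun x _ => ?_
    have hx : 0 ≤ π (x 0) * ∏ j : Fin (i + 1), P (x j.castSucc) (x j.succ) :=
      mul_nonneg (hπnn _) (Finset.prod_nonneg fun _ _ => hPnn _ _)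
    split_ifs <;> simp_all

/-- A set whose stationary mass is at most `1 / k` has expected hitting time at least
`(k - 1) / 2`. -/
lemma ofReal_le_expHitTime_of_stationary {X : Type*} [Fintype X] [DecidableEq X]
    {P : X → X → ℝ} (hPnn : ∀ a b, 0 ≤ P a b) {π : X → ℝ} (hπnn : ∀ x, 0 ≤ π x)
    (hstat : ∀ b, ∑ a, π a * P a b = π b) (Y : Finset X) (k : ℕ)
    (hk : k * ∑ x ∈ Y, π x ≤ 1) :
    ENNReal.ofReal (((k : ℝ) - 1) / 2) ≤ expHitTime P π Y := by
  set q := ∑ x ∈ Y, π x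
  have hq0 : 0 ≤ q := Finset.sum_nonneg fun x _ => hπnn x
  have hhit (j : ℕ) : ∑ i ∈ Finset.range (j + 1), hitDist P π Y i ≤ (j + 1) * q := by
    simpa using Finset.sum_le_card_nsmul (Finset.range (j + 1)) _ q
      fun i _ => hitDist_le_sum_of_stationary hPnn hπnn hstat Y i
  have hsum : ∀ l : ℕ, ∑ j ∈ Finset.range l, (1 - ((j : ℝ) + 1) * q) =
      l - l * (l + 1) / 2 * q := by
    intro l
    induction l with
    | zero => simp
    | succ l ih => rw [Finset.sum_range_succ, ih]; push_cast; ring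
  calc ENNReal.ofReal (((k : ℝ) - 1) / 2)
      ≤ ENNReal.ofReal (∑ j ∈ Finset.range k, (1 - ((j : ℝ) + 1) * q)) := by
        refine ENNReal.ofReal_le_ofReal ?_
        rw [hsum]
        nlinarith [mul_le_mul_of_nonneg_left hk (by positivity : (0 : ℝ) ≤ (k : ℝ) + 1)]
    _ = ∑ j ∈ Finset.range k, ENNReal.ofReal (1 - ((j : ℝ) + 1) * q) := by
        refine ENNReal.ofReal_sum_of_nonneg fun j hj => ?_
        have hjk : (j : ℝ) + 1 ≤ k := by exact_mod_cast Finset.mem_range.1 hj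
        nlinarith [mul_le_mul_of_nonneg_right hjk hq0]
    _ ≤ ∑ j ∈ Finset.range k,
          ENNReal.ofReal (1 - ∑ i ∈ Finset.range (j + 1), hitDist P π Y i) :=
        Finset.sum_le_sum fun j _ => ENNReal.ofReal_le_ofReal (sub_le_sub_left (hhit j) 1)
    _ ≤ expHitTime P π Y := ENNReal.sum_le_tsum _

/-- The set of pairs `s(σ (i, false), σ (i, true))` given by a labelling `σ` of the vertices. -/
def matchingOfEquiv {I V : Type*} [Fintype I] [DecidableEq V] (σ : I × Bool ≃ V) :
    Finset (Sym2 V) :=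
  Finset.univ.image fun i => s(σ (i, false), σ (i, true))

lemma isPerfectMatchingOn_matchingOfEquiv {I V : Type*} [Fintype I] [DecidableEq V]
    (σ : I × Bool ≃ V) : IsPerfectMatchingOn (⊤ : SimpleGraph V) (matchingOfEquiv σ) := by
  constructor
  · simp [matchingOfEquiv]
  · intro v
    obtain ⟨⟨i, b⟩, rfl⟩ := σ.surjective v
    refine ⟨s(σ (i, false), σ (i, true)), ⟨by simp [matchingOfEquiv], by cases b <;> simp⟩, ?_⟩
    rintro e ⟨he, hv⟩
    obtain ⟨j, -, rfl⟩ := Finset.mem_image.1 he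
    have hij : i = j := by
      rcases Sym2.mem_iff.1 hv with h | h <;> exact congrArg Prod.fst (σ.injective h)
    rw [hij]

/-- A finite set of unordered pairs comes from at most twice as many ordered pairs. -/
lemma card_filter_mk_mem_le {V : Type*} [Fintype V] [DecidableEq V] (S : Finset (Sym2 V)) :
    (Finset.univ.filter fun p : V × V => s(p.1, p.2) ∈ S).card ≤ 2 * S.card := by
  refine Finset.card_le_mul_card_image_of_maps_to (f := fun p : V × V => s(p.1, p.2))
    (by simp) 2 fun e _ => ?_
  induction e with
  | _ a b =>
    refine (Finset.card_le_card (t := {(a, b), (b, a)}) ?_).trans Finset.card_le_two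
    rintro ⟨c, d⟩ h
    have := (Finset.mem_filter.1 h).2
    simpa using this

/-- At most `(2 * #S) ^ #I` labellings have all their pairs in `S`. -/
lemma card_filter_matchingOfEquiv_subset_le {I V : Type*} [Fintype I] [DecidableEq I]
    [Fintype V] [DecidableEq V] (S : Finset (Sym2 V)) :
    (Finset.univ.filter fun σ : I × Bool ≃ V => matchingOfEquiv σ ⊆ S).card ≤
      (2 * S.card) ^ Fintype.card I := by
  calc _ ≤ (Fintype.piFinset fun _ : I =>
          Finset.univ.filter fun p : V × V => s(p.1, p.2) ∈ S).card := by
        refine Finset.card_le_card_of_injOn (fun σ i => (σ (i, false), σ (i, true))) ?_ ?_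
        · intro σ hσ
          have h := (Finset.mem_filter.1 hσ).2
          simp only [matchingOfEquiv, Finset.image_subset_iff] at h
          simpa using h
        · intro σ _ ρ _ h
          ext ⟨i, b⟩
          have hi := congrFun h i
          simp only [Prod.mk.injEq] at hi
          cases b
          exacts [hi.1, hi.2]
    _ ≤ _ := by
        rw [Fintype.card_piFinset, Finset.prod_const, Finset.card_univ]
        exact Nat.pow_le_pow_left (card_filter_mk_mem_le S) _

/-- Averaging over all labellings, some perfect matching is contained in `ξ x` with
`π`-probability at most `2 ^ n * m ^ n / (2 * n)!`. -/
lemma exists_matchingOfEquiv_factorial_mul_sum_le (n m : ℕ) {X : Type*} [Fintype X]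
    {π : X → ℝ} (hπnn : ∀ x, 0 ≤ π x) (hπsum : ∑ x, π x = 1)
    (ξ : X → Finset (Sym2 (Fin (2 * n)))) (hξcard : ∀ x, (ξ x).card ≤ m) :
    ∃ σ : Fin n × Bool ≃ Fin (2 * n),
      ((2 * n).factorial : ℝ) * ∑ x with matchingOfEquiv σ ⊆ ξ x, π x ≤ 2 ^ n * (m : ℝ) ^ n := by
  let σ₀ : Fin n × Bool ≃ Fin (2 * n) := Fintype.equivOfCardEq (by simp [mul_comm])
  have hcard : Fintype.card (Fin n × Bool ≃ Fin (2 * n)) = (2 * n).factorial := by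
    rw [Fintype.card_equiv σ₀]
    simp [mul_comm]
  by_contra! hlt
  have hsum := Finset.sum_lt_sum_of_nonempty ⟨σ₀, Finset.mem_univ σ₀⟩ fun σ _ => hlt σ
  rw [Finset.sum_const, Finset.card_univ, hcard, nsmul_eq_mul, ← Finset.mul_sum] at hsum
  refine (lt_of_mul_lt_mul_left hsum (Nat.cast_nonneg _)).not_ge ?_
  simp_rw [Finset.sum_filter]
  rw [Finset.sum_comm]
  calc _ ≤ ∑ x, π x * (2 ^ n * (m : ℝ) ^ n) := by
        refine Finset.sum_le_sum fun x _ => ?_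
        rw [← Finset.sum_filter, Finset.sum_const, nsmul_eq_mul, mul_comm]
        refine mul_le_mul_of_nonneg_left ?_ (hπnn x)
        rw [← mul_pow]
        have h := (card_filter_matchingOfEquiv_subset_le (I := Fin n) (ξ x)).trans
          (Nat.pow_le_pow_left (Nat.mul_le_mul_left 2 (hξcard x)) _)
        rw [Fintype.card_fin] at h
        exact_mod_cast h
    _ = _ := by rw [← Finset.sum_mul, hπsum, one_mul]

/-- Let `n ≥ 1`, `m ≥ n`, let `P` be a row-stochastic matrix on a nonempty finite set
`X` with stationary probability distribution `π`, and let `ξ` assign to each `x ∈ X`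
a set of at most `m` edges of the complete graph `K` on `2n` vertices. Then there is
a perfect matching `M` of `K` such that, for `Y = {x : M ⊆ ξ x}`, the expected hitting
time `τ` of `Y` started from `π` satisfies `τ ≥ (⌊(2n)!/(2^n·m^n)⌋ - 1)/2`. -/
theorem exists_matching_large_hitting_time (n m : ℕ) (hn : 1 ≤ n) (hm : n ≤ m)
    {X : Type*} [Fintype X] [DecidableEq X] [Nonempty X]
    (P : X → X → ℝ) (hPnn : ∀ a b, 0 ≤ P a b) (hProw : ∀ a, ∑ b, P a b = 1)
    (π : X → ℝ) (hπnn : ∀ x, 0 ≤ π x) (hπsum : ∑ x, π x = 1)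
    (hstat : ∀ b, ∑ a, π a * P a b = π b)
    (ξ : X → Finset (Sym2 (Fin (2 * n))))
    (hξedge : ∀ x, ∀ e ∈ ξ x, e ∈ (⊤ : SimpleGraph (Fin (2 * n))).edgeSet)
    (hξcard : ∀ x, (ξ x).card ≤ m) :
    ∃ M : Finset (Sym2 (Fin (2 * n))),
      IsPerfectMatchingOn (⊤ : SimpleGraph (Fin (2 * n))) M ∧
      ENNReal.ofReal (((⌊((2 * n).factorial : ℝ) / (2 ^ n * (m : ℝ) ^ n)⌋₊ : ℝ) - 1) / 2)
        ≤ expHitTime P π (Finset.univ.filter (fun x => M ⊆ ξ x)) := by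
  obtain ⟨σ, hσ⟩ := exists_matchingOfEquiv_factorial_mul_sum_le n m hπnn hπsum ξ hξcard
  refine ⟨matchingOfEquiv σ, isPerfectMatchingOn_matchingOfEquiv σ,
    ofReal_le_expHitTime_of_stationary hPnn hπnn hstat _ _ ?_⟩
  have hm0 : (0 : ℝ) < m := by exact_mod_cast hn.trans hm
  calc _ ≤ ((2 * n).factorial : ℝ) / (2 ^ n * (m : ℝ) ^ n) *
          ∑ x with matchingOfEquiv σ ⊆ ξ x, π x :=
        mul_le_mul_of_nonneg_right (Nat.floor_le (by positivity))
          (Finset.sum_nonneg fun x _ => hπnn x)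
    _ ≤ 1 := by
        rw [div_mul_eq_mul_div]
        exact div_le_one_of_le₀ hσ (by positivity)
end
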